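/- arXiv:2001.08881 — 2 statements merged into one kernel-verified Lean document; each statement's English description precedes it below -/
import Mathlib

section
/- Let G be a finite simple graph of order n with n ≡ 3 (mod 4), and let m be the integer 2^n · I(G, 1/2). Then the graph (G ∘ \overline{K_2}) + K_m has independence roots at i and −i. -/
open scoped Classical
open Polynomial

/-- `s` is an independent set of the simple graph `G`. -/
def SimpleGraph.IsIndepFinset {V : Type} (G : SimpleGraph V) (s : Finset V) : Prop :=
  ∀ u ∈ s, ∀ v ∈ s, ¬ G.Adj u v

/-- The independence polynomial of `G`, as a polynomial over `ℂ`: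
`I(G,x) = ∑_k s_k x^k` where `s_k` is the number of independent sets of cardinality `k`. -/
noncomputable def indepPoly {V : Type} [Fintype V] (G : SimpleGraph V) : Polynomial ℂ :=
  ∑ s ∈ Finset.univ.filter (fun s : Finset V => G.IsIndepFinset s), (X : Polynomial ℂ) ^ s.card

/-- The independence number of `G`. -/
noncomputable def indepNum {V : Type} [Fintype V] (G : SimpleGraph V) : ℕ :=
  (Finset.univ.filter (fun s : Finset V => G.IsIndepFinset s)).sup Finset.card

/-- The join `G + H` of two graphs: their disjoint union together with
all edges between the two parts. -/
def graphJoin {α β : Type} (G : SimpleGraph α) (H : SimpleGraph β) : SimpleGraph (α ⊕ β) where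
  Adj x y :=
    match x, y with
    | Sum.inl a, Sum.inl b => G.Adj a b
    | Sum.inr a, Sum.inr b => H.Adj a b
    | Sum.inl _, Sum.inr _ => True
    | Sum.inr _, Sum.inl _ => True
  symm := by
    refine ⟨?_⟩
    rintro (a | a) (b | b) h
    · exact G.adj_symm h
    · trivial
    · trivial
    · exact H.adj_symm h
  loopless := by
    refine ⟨?_⟩
    rintro (a | a) h
    · exact G.loopless.irrefl a h
    · exact H.loopless.irrefl a h

/-- `mK_n` : the disjoint union of `m` copies of the complete graph `K_n`. -/
def mClique (m n : ℕ) : SimpleGraph (Fin m × Fin n) where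
  Adj x y := x.1 = y.1 ∧ x ≠ y
  symm := by refine ⟨?_⟩; rintro x y ⟨h1, h2⟩; exact ⟨h1.symm, h2.symm⟩
  loopless := by refine ⟨?_⟩; rintro x ⟨_, h⟩; exact h rfl

/-- The lexicographic product `G[H]`. -/
def lexProd {α β : Type} (G : SimpleGraph α) (H : SimpleGraph β) : SimpleGraph (α × β) where
  Adj x y := G.Adj x.1 y.1 ∨ (x.1 = y.1 ∧ H.Adj x.2 y.2)
  symm := by
    refine ⟨?_⟩
    rintro x y (h | ⟨h1, h2⟩)
    · exact Or.inl (G.adj_symm h)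
    · exact Or.inr ⟨h1.symm, H.adj_symm h2⟩
  loopless := by
    refine ⟨?_⟩
    rintro x (h | ⟨-, h⟩)
    · exact G.loopless.irrefl _ h
    · exact H.loopless.irrefl _ h

/-- The corona `G ∘ H`: for each vertex `v` of `G`, add a new copy of `H`
joined completely to `v`. -/
def corona {α β : Type} (G : SimpleGraph α) (H : SimpleGraph β) : SimpleGraph (α ⊕ α × β) where
  Adj x y :=
    match x, y with
    | Sum.inl a, Sum.inl b => G.Adj a b
    | Sum.inl a, Sum.inr b => a = b.1
    | Sum.inr a, Sum.inl b => b = a.1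
    | Sum.inr a, Sum.inr b => a.1 = b.1 ∧ H.Adj a.2 b.2
  symm := by
    refine ⟨?_⟩
    rintro (a | a) (b | b) h
    · exact G.adj_symm h
    · exact h
    · exact h
    · exact ⟨h.1.symm, H.adj_symm h.2⟩
  loopless := by
    refine ⟨?_⟩
    rintro (a | a) h
    · exact G.loopless.irrefl a h
    · exact H.loopless.irrefl a.2 h.2

theorem eval_indepPoly {V : Type} [Fintype V] (G : SimpleGraph V) (x : ℂ) :
    (indepPoly G).eval x = ∑ s : Finset V, if G.IsIndepFinset s then x ^ s.card else 0 := by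
  simp [indepPoly, Polynomial.eval_finsetSum, ← Finset.sum_filter]

theorem eval_indepPoly_sum {α β : Type} [Fintype α] [Fintype β] (G : SimpleGraph (α ⊕ β)) (x : ℂ) :
    (indepPoly G).eval x = ∑ s : Finset α, ∑ t : Finset β,
      if G.IsIndepFinset (s.disjSum t) then x ^ (s.card + t.card) else 0 := by
  rw [eval_indepPoly, ← Fintype.sum_prod_type']
  symm
  refine Fintype.sum_equiv Finset.sumEquiv.toEquiv.symm _ _ ?_
  rintro ⟨s, t⟩
  simp [Finset.sumEquiv]

theorem SimpleGraph.isIndepFinset_empty {V : Type} (G : SimpleGraph V) : G.IsIndepFinset ∅ := by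
  simp [SimpleGraph.IsIndepFinset]

theorem graphJoin_isIndepFinset_disjSum {α β : Type} (G : SimpleGraph α) (H : SimpleGraph β)
    (s : Finset α) (t : Finset β) :
    (graphJoin G H).IsIndepFinset (s.disjSum t) ↔
      G.IsIndepFinset s ∧ H.IsIndepFinset t ∧ (s = ∅ ∨ t = ∅) := by
  simp only [SimpleGraph.IsIndepFinset, Sum.forall, Finset.inl_mem_disjSum,
    Finset.inr_mem_disjSum, graphJoin, Finset.eq_empty_iff_forall_notMem]
  grind

theorem eval_indepPoly_graphJoin {α β : Type} [Fintype α] [Fintype β]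
    (G : SimpleGraph α) (H : SimpleGraph β) (x : ℂ) :
    (indepPoly (graphJoin G H)).eval x = (indepPoly G).eval x + (indepPoly H).eval x - 1 := by
  have key (s : Finset α) (t : Finset β) :
      (if (graphJoin G H).IsIndepFinset (s.disjSum t) then x ^ (s.card + t.card) else 0) =
        (if t = ∅ then (if G.IsIndepFinset s then x ^ s.card else 0) else 0) +
        (if s = ∅ then (if H.IsIndepFinset t then x ^ t.card else 0) else 0) -
        (if t = ∅ then (if s = ∅ then 1 else 0) else 0) := by
    rw [graphJoin_isIndepFinset_disjSum]
    by_cases hs : s = ∅ <;> by_cases ht : t = ∅ <;>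
      simp [hs, ht, SimpleGraph.isIndepFinset_empty]
  rw [eval_indepPoly_sum, eval_indepPoly G, eval_indepPoly H]
  simp only [key, Finset.sum_sub_distrib, Finset.sum_add_distrib, Finset.sum_ite_eq',
    Finset.mem_univ, if_true]
  rw [Finset.sum_comm (f := fun (s : Finset α) (t : Finset β) =>
    if s = ∅ then (if H.IsIndepFinset t then x ^ t.card else 0) else 0)]
  simp

theorem eval_indepPoly_completeGraph {V : Type} [Fintype V] (x : ℂ) :
    (indepPoly (SimpleGraph.completeGraph V)).eval x = 1 + Fintype.card V * x := by
  have h : Finset.univ.filter (fun s : Finset V => (SimpleGraph.completeGraph V).IsIndepFinset s) =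
      insert ∅ (Finset.univ.image fun v : V => {v}) := by
    ext s
    have : (SimpleGraph.completeGraph V).IsIndepFinset s ↔ s.card ≤ 1 := by
      simp [SimpleGraph.IsIndepFinset, Finset.card_le_one, SimpleGraph.completeGraph]
    simp [this, Nat.le_one_iff_eq_zero_or_eq_one, Finset.card_eq_one, eq_comm]
  rw [indepPoly, h, Finset.sum_insert (by simp),
    Finset.sum_image (Finset.singleton_injective.injOn)]
  simp

theorem corona_isIndepFinset_disjSum {α β : Type} [Fintype α] [Fintype β] (G : SimpleGraph α)
    (s : Finset α) (t : Finset (α × β)) :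
    (corona G (SimpleGraph.emptyGraph β)).IsIndepFinset (s.disjSum t) ↔
      G.IsIndepFinset s ∧ t ∈ (sᶜ ×ˢ (Finset.univ : Finset β)).powerset := by
  simp only [SimpleGraph.IsIndepFinset, Sum.forall, Finset.inl_mem_disjSum,
    Finset.inr_mem_disjSum, corona, Finset.mem_powerset, Finset.subset_iff, Finset.mem_product,
    Finset.mem_compl, Finset.mem_univ, SimpleGraph.emptyGraph, Prod.forall]
  simp
  grind

theorem eval_indepPoly_corona_emptyGraph {α β : Type} [Fintype α] [Fintype β]
    (G : SimpleGraph α) (x : ℂ) :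
    (indepPoly (corona G (SimpleGraph.emptyGraph β))).eval x =
      ∑ s : Finset α, if G.IsIndepFinset s then
        x ^ s.card * ((x + 1) ^ Fintype.card β) ^ (Fintype.card α - s.card) else 0 := by
  rw [eval_indepPoly_sum]
  refine Finset.sum_congr rfl fun s _ => ?_
  simp only [corona_isIndepFinset_disjSum]
  split_ifs with hs
  · simp only [hs, true_and]
    rw [← Finset.sum_filter, Finset.filter_univ_mem]
    simp only [pow_add, ← Finset.mul_sum]
    have := Finset.sum_pow_mul_eq_add_pow x 1 (sᶜ ×ˢ (Finset.univ : Finset β))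
    simp only [one_pow, mul_one] at this
    rw [this, Finset.card_product, Finset.card_compl, Finset.card_univ, ← pow_mul,
      mul_comm (Fintype.card β)]
  · simp [hs]

theorem eval_indepPoly_corona_of_sq {V : Type} [Fintype V] (G : SimpleGraph V) {x : ℂ}
    (hx : x ^ 2 = -1) :
    (indepPoly (corona G (SimpleGraph.emptyGraph (Fin 2)))).eval x =
      x ^ Fintype.card V * (2 ^ Fintype.card V * (indepPoly G).eval (1 / 2)) := by
  rw [eval_indepPoly_corona_emptyGraph, eval_indepPoly, Finset.mul_sum, Finset.mul_sum]
  refine Finset.sum_congr rfl fun s _ => ?_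
  split_ifs
  · have h2 : (x + 1) ^ 2 = 2 * x := by linear_combination hx
    obtain ⟨k, hk⟩ := Nat.exists_eq_add_of_le (Finset.card_le_univ s)
    rw [Fintype.card_fin, h2, hk, Nat.add_sub_cancel_left, pow_add, pow_add, mul_pow, one_div,
      inv_pow]
    field_simp
  · simp

theorem eval_indepPoly_corona_graphJoin_eq_zero {V : Type} [Fintype V] (G : SimpleGraph V)
    (hn : Fintype.card V % 4 = 3) (m : ℕ)
    (hm : (m : ℂ) = 2 ^ Fintype.card V * (indepPoly G).eval (1 / 2)) {x : ℂ} (hx : x ^ 2 = -1) :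
    (indepPoly (graphJoin (corona G (SimpleGraph.emptyGraph (Fin 2)))
      (SimpleGraph.completeGraph (Fin m)))).eval x = 0 := by
  have hpow : x ^ Fintype.card V = -x := by
    have h4 : x ^ 4 = 1 := by linear_combination (x ^ 2 - 1) * hx
    rw [← Nat.div_add_mod (Fintype.card V) 4, hn, pow_add, pow_mul, h4]
    linear_combination x * hx
  rw [eval_indepPoly_graphJoin, eval_indepPoly_completeGraph, eval_indepPoly_corona_of_sq G hx,
    ← hm, hpow, Fintype.card_fin]
  ring

/-- If `G` has order `n ≡ 3 (mod 4)` and `m` is the integer `2ⁿ · I(G, 1/2)`, then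
`(G ∘ K̄₂) + K_m` has independence roots at `i` and `−i`. -/
theorem corona_join_has_root_I {V : Type} [Fintype V] (G : SimpleGraph V)
    (hn : Fintype.card V % 4 = 3) (m : ℕ)
    (hm : (m : ℂ) = 2 ^ Fintype.card V * (indepPoly G).eval (1 / 2)) :
    (indepPoly (graphJoin (corona G (SimpleGraph.emptyGraph (Fin 2)))
      (SimpleGraph.completeGraph (Fin m)))).eval Complex.I = 0 ∧
    (indepPoly (graphJoin (corona G (SimpleGraph.emptyGraph (Fin 2)))
      (SimpleGraph.completeGraph (Fin m)))).eval (-Complex.I) = 0 := by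
  exact ⟨eval_indepPoly_corona_graphJoin_eq_zero G hn m hm Complex.I_sq,
    eval_indepPoly_corona_graphJoin_eq_zero G hn m hm (by simp)⟩
end

section
/- The graph \overline{K_6} + K_8 (the join of 6 isolated vertices with a complete graph on 8 vertices, a connected graph of order 14) has independence polynomial (1+x)^6 + 8x, and has independence roots at i and −i. -/
open scoped Classical
open Polynomial

/-- A graph join of two nonempty graphs is connected. -/
theorem graphJoin_connected {α β : Type} [Nonempty α] [Nonempty β]
    (G : SimpleGraph α) (H : SimpleGraph β) : (graphJoin G H).Connected := by
  have cross (a : α) (b : β) : (graphJoin G H).Reachable (Sum.inl a) (Sum.inr b) :=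
    SimpleGraph.Adj.reachable (by trivial)
  obtain ⟨a₀⟩ := ‹Nonempty α›
  obtain ⟨b₀⟩ := ‹Nonempty β›
  refine (SimpleGraph.connected_iff_exists_forall_reachable _).2 ⟨Sum.inl a₀, ?_⟩
  rintro (a | b)
  · exact (cross a₀ b₀).trans (cross a b₀).symm
  · exact cross a₀ b

/-- A set is independent in a join iff it is an independent set of one of the two parts. -/
theorem isIndepFinset_graphJoin_iff {α β : Type} (G : SimpleGraph α) (H : SimpleGraph β)
    (s : Finset (α ⊕ β)) :
    (graphJoin G H).IsIndepFinset s ↔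
      (∃ t, G.IsIndepFinset t ∧ t.map Function.Embedding.inl = s) ∨
        ∃ t, H.IsIndepFinset t ∧ t.map Function.Embedding.inr = s := by
  constructor
  · intro h
    by_cases hr : ∃ b, Sum.inr b ∈ s
    · obtain ⟨b, hb⟩ := hr
      refine Or.inr ⟨s.toRight, fun u hu v hv => h (Sum.inr u) (Finset.mem_toRight.1 hu)
        (Sum.inr v) (Finset.mem_toRight.1 hv), ?_⟩
      ext (a | c)
      · have : Sum.inl a ∉ s := fun ha => h _ ha _ hb trivial
        simpa using this
      · simp
    · refine Or.inl ⟨s.toLeft, fun u hu v hv => h (Sum.inl u) (Finset.mem_toLeft.1 hu)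
        (Sum.inl v) (Finset.mem_toLeft.1 hv), ?_⟩
      ext (a | c)
      · simp
      · have : Sum.inr c ∉ s := fun hc => hr ⟨c, hc⟩
        simpa using this
  · rintro (⟨t, ht, rfl⟩ | ⟨t, ht, rfl⟩) <;>
    · intro u hu v hv
      obtain ⟨a, ha, rfl⟩ := Finset.mem_map.1 hu
      obtain ⟨b, hb, rfl⟩ := Finset.mem_map.1 hv
      exact ht a ha b hb

/-- The independence polynomial of a join: `I(G + H, x) + 1 = I(G, x) + I(H, x)`. -/
theorem indepPoly_graphJoin_add_one {α β : Type} [Fintype α] [Fintype β]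
    (G : SimpleGraph α) (H : SimpleGraph β) :
    indepPoly (graphJoin G H) + 1 = indepPoly G + indepPoly H := by
  set A := (Finset.univ.filter fun s : Finset α => G.IsIndepFinset s).map
    (Finset.mapEmbedding (Function.Embedding.inl (β := β))).toEmbedding with hA
  set B := (Finset.univ.filter fun s : Finset β => H.IsIndepFinset s).map
    (Finset.mapEmbedding (Function.Embedding.inr (α := α))).toEmbedding with hB
  have hunion : Finset.univ.filter (fun s => (graphJoin G H).IsIndepFinset s) = A ∪ B := by
    ext s
    simp [hA, hB, isIndepFinset_graphJoin_iff, Finset.mapEmbedding_apply]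
  have hinter : A ∩ B = {∅} := by
    ext s
    simp only [hA, hB, Finset.mem_inter, Finset.mem_map, Finset.mem_filter, Finset.mem_univ,
      true_and, RelEmbedding.coe_toEmbedding, Finset.mapEmbedding_apply, Finset.mem_singleton]
    constructor
    · rintro ⟨⟨t, -, rfl⟩, ⟨u, -, hu⟩⟩
      refine Finset.eq_empty_of_forall_notMem fun x hx => ?_
      have hx' := hx
      rw [← hu] at hx'
      obtain ⟨a, -, rfl⟩ := Finset.mem_map.1 hx
      simp at hx'
    · rintro rfl
      exact ⟨⟨∅, by simp [SimpleGraph.IsIndepFinset]⟩, ⟨∅, by simp [SimpleGraph.IsIndepFinset]⟩⟩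
  have h := Finset.sum_union_inter (s₁ := A) (s₂ := B) (f := fun s => (X : ℂ[X]) ^ s.card)
  rw [← hunion, hinter, hA, hB, Finset.sum_map, Finset.sum_map] at h
  simpa [indepPoly, Finset.mapEmbedding_apply] using h

theorem indepPoly_emptyGraph (α : Type) [Fintype α] :
    indepPoly (SimpleGraph.emptyGraph α) = (1 + X) ^ Fintype.card α := by
  have h := Fintype.sum_pow_mul_eq_add_pow α (X : ℂ[X]) 1
  simp only [one_pow, mul_one] at h
  simp [indepPoly, SimpleGraph.IsIndepFinset, h, add_comm]

theorem isIndepFinset_completeGraph_iff {α : Type} (s : Finset α) :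
    (SimpleGraph.completeGraph α).IsIndepFinset s ↔ s = ∅ ∨ ∃ a, {a} = s := by
  constructor
  · intro h
    refine s.eq_empty_or_nonempty.imp_right fun ⟨a, ha⟩ => ⟨a, ?_⟩
    refine (Finset.eq_singleton_iff_unique_mem.2 ⟨ha, fun b hb => ?_⟩).symm
    by_contra hne
    exact h b hb a ha hne
  · rintro (rfl | ⟨a, rfl⟩) <;> simp [SimpleGraph.IsIndepFinset]

theorem indepPoly_completeGraph (α : Type) [Fintype α] :
    indepPoly (SimpleGraph.completeGraph α) = 1 + C (Fintype.card α : ℂ) * X := by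
  have h : Finset.univ.filter (fun s => (SimpleGraph.completeGraph α).IsIndepFinset s) =
      insert ∅ (Finset.univ.map ⟨singleton, Finset.singleton_injective⟩) := by
    ext s
    simp only [Finset.mem_filter, Finset.mem_univ, true_and, isIndepFinset_completeGraph_iff,
      Finset.mem_insert, Finset.mem_map, Function.Embedding.coeFn_mk]
  rw [indepPoly, h, Finset.sum_insert (by simp), Finset.sum_map]
  simp

/-- The graph `K̄₆ + K₈` is connected, has order `14`, has independence polynomial
`(1+x)⁶ + 8x`, and has independence roots at `i` and `−i`. -/
theorem emptySix_join_completeEight_has_root_I :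
    (graphJoin (SimpleGraph.emptyGraph (Fin 6)) (SimpleGraph.completeGraph (Fin 8))).Connected ∧
    Fintype.card (Fin 6 ⊕ Fin 8) = 14 ∧
    indepPoly (graphJoin (SimpleGraph.emptyGraph (Fin 6)) (SimpleGraph.completeGraph (Fin 8))) =
      (1 + X) ^ 6 + C (8 : ℂ) * X ∧
    (indepPoly (graphJoin (SimpleGraph.emptyGraph (Fin 6)) (SimpleGraph.completeGraph (Fin 8)))).eval Complex.I = 0 ∧
    (indepPoly (graphJoin (SimpleGraph.emptyGraph (Fin 6)) (SimpleGraph.completeGraph (Fin 8)))).eval (-Complex.I)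
      = 0 := by
  have hpoly : indepPoly (graphJoin (SimpleGraph.emptyGraph (Fin 6))
      (SimpleGraph.completeGraph (Fin 8))) = (1 + X) ^ 6 + C (8 : ℂ) * X := by
    have h := indepPoly_graphJoin_add_one (SimpleGraph.emptyGraph (Fin 6))
      (SimpleGraph.completeGraph (Fin 8))
    rw [indepPoly_emptyGraph, indepPoly_completeGraph, Fintype.card_fin, Fintype.card_fin,
      Nat.cast_ofNat] at h
    linear_combination h
  have hI := Complex.I_sq
  refine ⟨graphJoin_connected _ _, by simp, hpoly, ?_, ?_⟩
  · rw [hpoly]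
    simp only [eval_add, eval_pow, eval_one, eval_X, eval_mul, eval_C]
    have h2 : (1 + Complex.I) ^ 2 = 2 * Complex.I := by linear_combination hI
    rw [show (1 + Complex.I) ^ 6 = ((1 + Complex.I) ^ 2) ^ 3 by ring, h2]
    linear_combination 8 * Complex.I * hI
  · rw [hpoly]
    simp only [eval_add, eval_pow, eval_one, eval_X, eval_mul, eval_C]
    have h2 : (1 + -Complex.I) ^ 2 = -2 * Complex.I := by linear_combination hI
    rw [show (1 + -Complex.I) ^ 6 = ((1 + -Complex.I) ^ 2) ^ 3 by ring, h2]
    linear_combination -8 * Complex.I * hI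
end
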